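/- Let (J^ℱ,(f_n)) and (J^𝒢,(g_n)) be two unimodal nonautonomous discrete dynamical systems with the same kneading sequence, and assume that 𝒞_n(𝒢) is dense in J^𝒢 for all n≥1. Then there exists a sequence (h_n)_{n≥1} of order-preserving (monotone nondecreasing) continuous surjective maps h_n:J^ℱ→J^𝒢 such that h_{n+1}∘f_n=g_n∘h_n for each n≥1, and such that for each n the restriction of h_n to 𝒞_n(ℱ) is a strictly increasing bijection from 𝒞_n(ℱ) onto 𝒞_n(𝒢) satisfying h_{n+1}(f_n(x))=g_n(h_n(x)) for all x∈𝒞_n(ℱ)∖{c_n^ℱ}. -/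

import Mathlib

open Set

noncomputable section

/-- The nonautonomous iterate `f_n^ℓ = f_{n+ℓ-1} ∘ ⋯ ∘ f_n` (and `f_n^0 = id`). -/
def iterFrom (f : ℕ → ℝ → ℝ) : ℕ → ℕ → ℝ → ℝ
  | _, 0, x => x
  | n, ℓ + 1, x => f (n + ℓ) (iterFrom f n ℓ x)

/-- `(Icc a b, (f n))` is a unimodal nonautonomous discrete dynamical system with
turning points `c n`. -/
def IsUNDS (a b : ℝ) (f : ℕ → ℝ → ℝ) (c : ℕ → ℝ) : Prop :=
  a < b ∧ ∀ n : ℕ,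
    ContinuousOn (f n) (Icc a b) ∧
    MapsTo (f n) (Icc a b) (Icc a b) ∧
    f n a = a ∧ f n b = a ∧
    c n ∈ Ioo a b ∧
    StrictMonoOn (f n) (Icc a (c n)) ∧
    StrictAntiOn (f n) (Icc (c n) b)

/-- The two systems have the same kneading sequence (`𝕍(ℱ) = 𝕍(𝒢)`). -/
def SameKneading (f : ℕ → ℝ → ℝ) (cF : ℕ → ℝ) (g : ℕ → ℝ → ℝ) (cG : ℕ → ℝ) : Prop :=
  ∀ n ℓ : ℕ,
    (iterFrom f n ℓ (cF n) < cF (n + ℓ) ↔ iterFrom g n ℓ (cG n) < cG (n + ℓ)) ∧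
    (iterFrom f n ℓ (cF n) = cF (n + ℓ) ↔ iterFrom g n ℓ (cG n) = cG (n + ℓ))

/-- `𝒞_n(ℱ)`: points of `Icc a b` eventually mapped onto a turning point. -/
def critSet (a b : ℝ) (f : ℕ → ℝ → ℝ) (c : ℕ → ℝ) (n : ℕ) : Set ℝ :=
  {x ∈ Icc a b | ∃ ℓ : ℕ, iterFrom f n ℓ x = c (n + ℓ)}

theorem iterFrom_succ' (f : ℕ → ℝ → ℝ) (n ℓ : ℕ) (x : ℝ) :
    iterFrom f n (ℓ + 1) x = iterFrom f (n + 1) ℓ (f n x) := by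
  induction ℓ with
  | zero => rfl
  | succ k ih =>
    rw [iterFrom, ih, iterFrom, show n + (k + 1) = n + 1 + k by ring]

/-- The points `x` and `y` visit the same sides of the respective turning points under the two
systems started at time `n`. -/
def SameItinerary (f : ℕ → ℝ → ℝ) (cF : ℕ → ℝ) (g : ℕ → ℝ → ℝ) (cG : ℕ → ℝ)
    (n : ℕ) (x y : ℝ) : Prop :=
  ∀ ℓ : ℕ,
    (iterFrom f n ℓ x < cF (n + ℓ) ↔ iterFrom g n ℓ y < cG (n + ℓ)) ∧
    (iterFrom f n ℓ x = cF (n + ℓ) ↔ iterFrom g n ℓ y = cG (n + ℓ))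

section

variable {f g : ℕ → ℝ → ℝ} {cF cG c : ℕ → ℝ} {a b aF bF aG bG x x' y y' z : ℝ} {n : ℕ}

theorem SameItinerary.symm (h : SameItinerary f cF g cG n x y) :
    SameItinerary g cG f cF n y x :=
  fun ℓ => ⟨(h ℓ).1.symm, (h ℓ).2.symm⟩

theorem SameKneading.symm (h : SameKneading f cF g cG) : SameKneading g cG f cF :=
  fun n ℓ => ⟨(h n ℓ).1.symm, (h n ℓ).2.symm⟩

theorem SameKneading.sameItinerary (h : SameKneading f cF g cG) (n : ℕ) :
    SameItinerary f cF g cG n (cF n) (cG n) :=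
  h n

theorem SameItinerary.lt_iff (h : SameItinerary f cF g cG n x y) : x < cF n ↔ y < cG n :=
  (h 0).1

theorem SameItinerary.eq_iff (h : SameItinerary f cF g cG n x y) : x = cF n ↔ y = cG n :=
  (h 0).2

theorem SameItinerary.gt_iff (h : SameItinerary f cF g cG n x y) : cF n < x ↔ cG n < y := by
  have h₁ := h.lt_iff
  have h₂ := h.eq_iff
  constructor <;> intro h₃
  · exact lt_of_le_of_ne (not_lt.1 (by grind)) (by grind)
  · exact lt_of_le_of_ne (not_lt.1 (by grind)) (by grind)

theorem SameItinerary.map (h : SameItinerary f cF g cG n x y) :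
    SameItinerary f cF g cG (n + 1) (f n x) (g n y) := by
  intro ℓ
  have := h (ℓ + 1)
  rwa [iterFrom_succ', iterFrom_succ', show n + (ℓ + 1) = n + 1 + ℓ by ring] at this

theorem SameItinerary.of_map (h₁ : x < cF n ↔ y < cG n) (h₂ : x = cF n ↔ y = cG n)
    (h : SameItinerary f cF g cG (n + 1) (f n x) (g n y)) : SameItinerary f cF g cG n x y := by
  rintro (_ | ℓ)
  · exact ⟨h₁, h₂⟩
  · rw [iterFrom_succ', iterFrom_succ', show n + (ℓ + 1) = n + 1 + ℓ by ring]
    exact h ℓ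

theorem SameItinerary.mem_critSet (h : SameItinerary f cF g cG n x y) (hy : y ∈ Icc aG bG)
    (hx : x ∈ critSet aF bF f cF n) : y ∈ critSet aG bG g cG n := by
  obtain ⟨-, ℓ, hℓ⟩ := hx
  exact ⟨hy, ℓ, (h ℓ).2.1 hℓ⟩

theorem mem_critSet_of_map (hx : x ∈ Icc a b) (h : f n x ∈ critSet a b f c (n + 1)) :
    x ∈ critSet a b f c n := by
  obtain ⟨-, ℓ, hℓ⟩ := h
  refine ⟨hx, ℓ + 1, ?_⟩
  rw [iterFrom_succ', hℓ, show n + (ℓ + 1) = n + 1 + ℓ by ring]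

namespace IsUNDS

theorem turning_mem (hF : IsUNDS a b f c) (n : ℕ) : c n ∈ Icc a b :=
  Ioo_subset_Icc_self (hF.2 n).2.2.2.2.1

theorem mapsTo (hF : IsUNDS a b f c) (n : ℕ) : MapsTo (f n) (Icc a b) (Icc a b) :=
  (hF.2 n).2.1

theorem strictMonoOn (hF : IsUNDS a b f c) (n : ℕ) : StrictMonoOn (f n) (Icc a (c n)) :=
  (hF.2 n).2.2.2.2.2.1

theorem strictAntiOn (hF : IsUNDS a b f c) (n : ℕ) : StrictAntiOn (f n) (Icc (c n) b) :=
  (hF.2 n).2.2.2.2.2.2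

theorem turning_mem_critSet (hF : IsUNDS a b f c) (n : ℕ) : c n ∈ critSet a b f c n :=
  ⟨hF.turning_mem n, 0, rfl⟩

theorem exists_left_preimage (hF : IsUNDS a b f c) (hy : y ∈ Icc a b) (h : y ≤ f n (c n)) :
    ∃ x ∈ Icc a (c n), f n x = y := by
  obtain ⟨hc, -, ha, -, hm, -⟩ := hF.2 n
  exact intermediate_value_Icc hm.1.le (hc.mono (Icc_subset_Icc_right hm.2.le))
    ⟨by rw [ha]; exact hy.1, h⟩

theorem exists_right_preimage (hF : IsUNDS a b f c) (hy : y ∈ Icc a b) (h : y ≤ f n (c n)) :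
    ∃ x ∈ Icc (c n) b, f n x = y := by
  obtain ⟨hc, -, -, hb, hm, -⟩ := hF.2 n
  exact intermediate_value_Icc' hm.2.le (hc.mono (Icc_subset_Icc_left hm.1.le))
    ⟨by rw [hb]; exact hy.1, h⟩

theorem map_le_turning (hF : IsUNDS a b f c) (hx : x ∈ Icc a b) : f n x ≤ f n (c n) := by
  have hm := hF.turning_mem n
  rcases le_total x (c n) with h | h
  · exact (hF.strictMonoOn n).monotoneOn ⟨hx.1, h⟩ ⟨hm.1, le_rfl⟩ h
  · exact (hF.strictAntiOn n).antitoneOn ⟨le_rfl, hm.2⟩ ⟨h, hx.2⟩ h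

end IsUNDS

/-- If one of two points is precritical, their order is determined by the itineraries. -/
theorem SameItinerary.lt_iff_lt_and (hF : IsUNDS aF bF f cF) (hG : IsUNDS aG bG g cG)
    (hx : x ∈ critSet aF bF f cF n) (hx' : x' ∈ Icc aF bF)
    (hy : y ∈ Icc aG bG) (hy' : y' ∈ Icc aG bG)
    (h : SameItinerary f cF g cG n x y) (h' : SameItinerary f cF g cG n x' y') :
    (x < x' ↔ y < y') ∧ (x' < x ↔ y' < y) := by
  obtain ⟨hx, ℓ, hℓ⟩ := hx
  induction ℓ generalizing n x x' y y' with
  | zero =>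
    obtain rfl : x = cF n := hℓ
    obtain rfl : y = cG n := h.eq_iff.1 rfl
    exact ⟨h'.gt_iff, h'.lt_iff⟩
  | succ ℓ ih =>
    rw [iterFrom_succ', show n + (ℓ + 1) = n + 1 + ℓ by ring] at hℓ
    have key := ih (hF.mapsTo n hx') (hG.mapsTo n hy) (hG.mapsTo n hy') h.map h'.map
      (hF.mapsTo n hx) hℓ
    have h₁ := h.lt_iff
    have h₂ := h.gt_iff
    have h₃ := h'.lt_iff
    have h₄ := h'.gt_iff
    by_cases hl : x ≤ cF n ∧ x' ≤ cF n
    · have hl' : y ≤ cG n ∧ y' ≤ cG n := by grind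
      have mF := hF.strictMonoOn n
      have mG := hG.strictMonoOn n
      rw [mF.lt_iff_lt ⟨hx.1, hl.1⟩ ⟨hx'.1, hl.2⟩, mF.lt_iff_lt ⟨hx'.1, hl.2⟩ ⟨hx.1, hl.1⟩,
        mG.lt_iff_lt ⟨hy.1, hl'.1⟩ ⟨hy'.1, hl'.2⟩,
        mG.lt_iff_lt ⟨hy'.1, hl'.2⟩ ⟨hy.1, hl'.1⟩] at key
      exact key
    by_cases hr : cF n ≤ x ∧ cF n ≤ x'
    · have hr' : cG n ≤ y ∧ cG n ≤ y' := by grind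
      have mF := hF.strictAntiOn n
      have mG := hG.strictAntiOn n
      rw [mF.lt_iff_gt ⟨hr.1, hx.2⟩ ⟨hr.2, hx'.2⟩, mF.lt_iff_gt ⟨hr.2, hx'.2⟩ ⟨hr.1, hx.2⟩,
        mG.lt_iff_gt ⟨hr'.1, hy.2⟩ ⟨hr'.2, hy'.2⟩,
        mG.lt_iff_gt ⟨hr'.2, hy'.2⟩ ⟨hr'.1, hy.2⟩] at key
      exact ⟨key.2, key.1⟩
    grind

theorem SameItinerary.le_of_le (hF : IsUNDS aF bF f cF) (hG : IsUNDS aG bG g cG)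
    (hx : x ∈ critSet aF bF f cF n) (hx' : x' ∈ Icc aF bF)
    (hy : y ∈ Icc aG bG) (hy' : y' ∈ Icc aG bG)
    (h : SameItinerary f cF g cG n x y) (h' : SameItinerary f cF g cG n x' y') :
    (x ≤ x' → y ≤ y') ∧ (x' ≤ x → y' ≤ y) := by
  have := h.lt_iff_lt_and hF hG hx hx' hy hy' h'
  grind

theorem SameItinerary.eq_of_eq (hF : IsUNDS aF bF f cF) (hG : IsUNDS aG bG g cG)
    (hx : x ∈ critSet aF bF f cF n) (hy : y ∈ Icc aG bG) (hy' : y' ∈ Icc aG bG)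
    (h : SameItinerary f cF g cG n x y) (h' : SameItinerary f cF g cG n x y') : y = y' :=
  have key := h.le_of_le hF hG hx hx.1 hy hy' h'
  le_antisymm (key.1 le_rfl) (key.2 le_rfl)

/-- Systems with the same kneading sequence realise the same itineraries of precritical points. -/
theorem exists_sameItinerary (hF : IsUNDS aF bF f cF) (hG : IsUNDS aG bG g cG)
    (hk : SameKneading f cF g cG) (hx : x ∈ critSet aF bF f cF n) :
    ∃ y ∈ Icc aG bG, SameItinerary f cF g cG n x y := by
  obtain ⟨hx, ℓ, hℓ⟩ := hx
  induction ℓ generalizing n x with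
  | zero =>
    obtain rfl : x = cF n := hℓ
    exact ⟨cG n, hG.turning_mem n, hk.sameItinerary n⟩
  | succ ℓ ih =>
    rw [iterFrom_succ', show n + (ℓ + 1) = n + 1 + ℓ by ring] at hℓ
    have hfx := hF.mapsTo n hx
    have hm := hF.turning_mem n
    have hmG := hG.turning_mem n
    obtain ⟨z, hz, hxz⟩ := ih hfx hℓ
    have key := (hxz.lt_iff_lt_and hF hG ⟨hfx, ℓ, hℓ⟩ (hF.mapsTo n hm) hz
      (hG.mapsTo n hmG) (hk.sameItinerary n).map).1
    rcases lt_trichotomy x (cF n) with h | rfl | h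
    · have hlt := key.1 (hF.strictMonoOn n ⟨hx.1, h.le⟩ ⟨hm.1, le_rfl⟩ h)
      obtain ⟨y, hy, rfl⟩ := hG.exists_left_preimage hz hlt.le
      have hne : y ≠ cG n := by rintro rfl; exact lt_irrefl _ hlt
      have hy' := lt_of_le_of_ne hy.2 hne
      exact ⟨y, ⟨hy.1, hy.2.trans hmG.2⟩, .of_map (iff_of_true h hy') (iff_of_false h.ne hne) hxz⟩
    · exact ⟨cG n, hmG, hk.sameItinerary n⟩
    · have hlt := key.1 (hF.strictAntiOn n ⟨le_rfl, hm.2⟩ ⟨h.le, hx.2⟩ h)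
      obtain ⟨y, hy, rfl⟩ := hG.exists_right_preimage hz hlt.le
      have hne : y ≠ cG n := by rintro rfl; exact lt_irrefl _ hlt
      exact ⟨y, ⟨hmG.1.trans hy.1, hy.2⟩,
        .of_map (iff_of_false h.not_gt hy.1.not_gt) (iff_of_false h.ne' hne) hxz⟩

/-- The point `y` occupies the same position relative to the precritical points of the second
system as `x` does relative to those of the first. -/
def IsCut (aF bF aG bG : ℝ) (f : ℕ → ℝ → ℝ) (cF : ℕ → ℝ) (g : ℕ → ℝ → ℝ) (cG : ℕ → ℝ)
    (n : ℕ) (x y : ℝ) : Prop :=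
  ∀ x' ∈ critSet aF bF f cF n, ∀ y' ∈ Icc aG bG, SameItinerary f cF g cG n x' y' →
    (x' ≤ x → y' ≤ y) ∧ (x ≤ x' → y ≤ y')

theorem SameItinerary.isCut (hF : IsUNDS aF bF f cF) (hG : IsUNDS aG bG g cG)
    (hx : x ∈ Icc aF bF) (hy : y ∈ Icc aG bG) (h : SameItinerary f cF g cG n x y) :
    IsCut aF bF aG bG f cF g cG n x y :=
  fun _ hx' _ hy' h' => h'.le_of_le hF hG hx' hx hy' hy h

theorem exists_isCut (hF : IsUNDS aF bF f cF) (hG : IsUNDS aG bG g cG) (n : ℕ) (x : ℝ) :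
    ∃ y ∈ Icc aG bG, IsCut aF bF aG bG f cF g cG n x y := by
  set S : Set ℝ := insert aG {y | y ∈ Icc aG bG ∧
    ∃ x' ∈ critSet aF bF f cF n, x' ≤ x ∧ SameItinerary f cF g cG n x' y}
  have hS : bG ∈ upperBounds S := by
    rintro y (rfl | hy)
    · exact hG.1.le
    · exact hy.1.2
  have hne : S.Nonempty := ⟨aG, mem_insert _ _⟩
  refine ⟨sSup S, ⟨le_csSup ⟨_, hS⟩ (mem_insert _ _), csSup_le hne hS⟩, ?_⟩
  intro x' hx' y' hy' h
  refine ⟨fun hle => le_csSup ⟨_, hS⟩ (Or.inr ⟨hy', x', hx', hle, h⟩), fun hle => csSup_le hne ?_⟩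
  rintro z (rfl | ⟨hz, u, hu, hux, huz⟩)
  · exact hy'.1
  · exact (huz.le_of_le hF hG hu hx'.1 hz hy' h).1 (hux.trans hle)

theorem IsCut.le_of_le (hF : IsUNDS aF bF f cF) (hG : IsUNDS aG bG g cG)
    (hk : SameKneading f cF g cG) (hd : Icc aG bG ⊆ closure (critSet aG bG g cG n))
    (hy : y ∈ Icc aG bG) (hy' : y' ∈ Icc aG bG)
    (h : IsCut aF bF aG bG f cF g cG n x y) (h' : IsCut aF bF aG bG f cF g cG n x' y')
    (hle : x ≤ x') : y ≤ y' := by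
  by_contra! hlt
  obtain ⟨m, hm₁, hm₂⟩ := exists_between hlt
  obtain ⟨v, ⟨hv₁, hv₂⟩, hv⟩ := mem_closure_iff.1 (hd ⟨hy'.1.trans hm₁.le, hm₂.le.trans hy.2⟩)
    (Ioo y' y) isOpen_Ioo ⟨hm₁, hm₂⟩
  obtain ⟨u, hu, huv⟩ := exists_sameItinerary hG hF hk.symm hv
  have hu' := huv.mem_critSet hu hv
  rcases le_total u x' with hux | hux
  · exact hv₁.not_ge ((h' u hu' v hv.1 huv.symm).1 hux)
  · exact hv₂.not_ge ((h u hu' v hv.1 huv.symm).2 (hle.trans hux))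

theorem IsCut.map (hF : IsUNDS aF bF f cF) (hG : IsUNDS aG bG g cG)
    (hk : SameKneading f cF g cG) (hx : x ∈ Icc aF bF) (hy : y ∈ Icc aG bG)
    (h : IsCut aF bF aG bG f cF g cG n x y) :
    IsCut aF bF aG bG f cF g cG (n + 1) (f n x) (g n y) := by
  intro u hu v hv huv
  have hm := hF.turning_mem n
  have hmG := hG.turning_mem n
  have hc := h _ (hF.turning_mem_critSet n) _ hmG (hk.sameItinerary n)
  rcases lt_or_ge (f n (cF n)) u with hcu | hcu
  · have hv' := (huv.lt_iff_lt_and hF hG hu (hF.mapsTo n hm) hv (hG.mapsTo n hmG)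
      (hk.sameItinerary n).map).2.1 hcu
    exact ⟨fun hle => absurd (hle.trans (hF.map_le_turning hx)) hcu.not_ge,
      fun _ => (hG.map_le_turning hy).trans hv'.le⟩
  have lift : ∀ w ∈ Icc aF bF, f n w = u → ∃ z ∈ Icc aG bG, g n z = v ∧
      SameItinerary f cF g cG n w z ∧ (w ≤ x → z ≤ y) ∧ (x ≤ w → y ≤ z) := by
    rintro w hw rfl
    have hw' := mem_critSet_of_map hw hu
    obtain ⟨z, hz, hwz⟩ := exists_sameItinerary hF hG hk hw'
    exact ⟨z, hz, hwz.map.eq_of_eq hF hG hu (hG.mapsTo n hz) hv huv, hwz, h w hw' z hz hwz⟩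
  rcases le_total x (cF n) with hxc | hxc
  · obtain ⟨w, hw, hwu⟩ := hF.exists_left_preimage hu.1 hcu
    obtain ⟨z, hz, rfl, hwz, hz₁, hz₂⟩ := lift w ⟨hw.1, hw.2.trans hm.2⟩ hwu
    have hzc : z ≤ cG n := not_lt.1 fun hlt => (hwz.gt_iff.2 hlt).not_ge hw.2
    have mG := (hG.strictMonoOn n).monotoneOn
    rw [← hwu, (hF.strictMonoOn n).le_iff_le hw ⟨hx.1, hxc⟩,
      (hF.strictMonoOn n).le_iff_le ⟨hx.1, hxc⟩ hw]
    exact ⟨fun hle => mG ⟨hz.1, hzc⟩ ⟨hy.1, hc.2 hxc⟩ (hz₁ hle),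
      fun hle => mG ⟨hy.1, hc.2 hxc⟩ ⟨hz.1, hzc⟩ (hz₂ hle)⟩
  · obtain ⟨w, hw, hwu⟩ := hF.exists_right_preimage hu.1 hcu
    obtain ⟨z, hz, rfl, hwz, hz₁, hz₂⟩ := lift w ⟨hm.1.trans hw.1, hw.2⟩ hwu
    have hzc : cG n ≤ z := not_lt.1 fun hlt => (hwz.lt_iff.2 hlt).not_ge hw.1
    have mG := (hG.strictAntiOn n).antitoneOn
    rw [← hwu, (hF.strictAntiOn n).le_iff_ge hw ⟨hxc, hx.2⟩,
      (hF.strictAntiOn n).le_iff_ge ⟨hxc, hx.2⟩ hw]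
    exact ⟨fun hle => mG ⟨hc.1 hxc, hy.2⟩ ⟨hzc, hz.2⟩ (hz₂ hle),
      fun hle => mG ⟨hzc, hz.2⟩ ⟨hc.1 hxc, hy.2⟩ (hz₁ hle)⟩

theorem MonotoneOn.continuousOn_Icc_of_subset_closure_image {φ : ℝ → ℝ}
    (hφ : MonotoneOn φ (Icc a b)) (hm : MapsTo φ (Icc a b) (Icc aG bG))
    (hd : Icc aG bG ⊆ closure (φ '' Icc a b)) : ContinuousOn φ (Icc a b) := by
  have hmono : Monotone (hm.restrict φ (Icc a b) (Icc aG bG)) :=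
    fun u v huv => hφ u.2 v.2 huv
  have hdense : DenseRange (hm.restrict φ (Icc a b) (Icc aG bG)) := by
    intro z
    rw [closure_subtype, ← range_comp]
    refine closure_mono ?_ (hd z.2)
    rintro _ ⟨u, hu, rfl⟩
    exact ⟨⟨u, hu⟩, rfl⟩
  rw [continuousOn_iff_continuous_domRestrict]
  exact continuous_subtype_val.comp (hmono.continuous_of_denseRange hdense)

end

/-- If two UNDS have the same kneading sequence and `𝒞_n(𝒢)` is dense in `J^𝒢` for
all `n`, then there is a sequence of order-preserving (monotone nondecreasing)
continuous surjections `h n : J^ℱ → J^𝒢` with `h (n+1) ∘ f n = g n ∘ h n`, each of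
which restricts to a strictly increasing bijection `𝒞_n(ℱ) → 𝒞_n(𝒢)` intertwining
the dynamics away from the turning point. -/
theorem exists_semiconjugacy_of_sameKneading_of_dense
    (aF bF aG bG : ℝ) (f g : ℕ → ℝ → ℝ) (cF cG : ℕ → ℝ)
    (hF : IsUNDS aF bF f cF) (hG : IsUNDS aG bG g cG)
    (hknead : SameKneading f cF g cG)
    (hdense : ∀ n : ℕ, Icc aG bG ⊆ closure (critSet aG bG g cG n)) :
    ∃ h : ℕ → ℝ → ℝ,
      (∀ n, MonotoneOn (h n) (Icc aF bF)) ∧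
      (∀ n, ContinuousOn (h n) (Icc aF bF)) ∧
      (∀ n, MapsTo (h n) (Icc aF bF) (Icc aG bG)) ∧
      (∀ n, SurjOn (h n) (Icc aF bF) (Icc aG bG)) ∧
      (∀ n, ∀ x ∈ Icc aF bF, h (n + 1) (f n x) = g n (h n x)) ∧
      (∀ n, StrictMonoOn (h n) (critSet aF bF f cF n)) ∧
      (∀ n, BijOn (h n) (critSet aF bF f cF n) (critSet aG bG g cG n)) ∧
      (∀ n, ∀ x ∈ critSet aF bF f cF n \ {cF n}, h (n + 1) (f n x) = g n (h n x)) := by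
  choose h hmem hcut using exists_isCut (aF := aF) (bF := bF) hF hG
  have hmono : ∀ n, Monotone (h n) := fun n u v huv =>
    (hcut n u).le_of_le hF hG hknead (hdense n) (hmem n u) (hmem n v) (hcut n v) huv
  have huniq : ∀ n x y, y ∈ Icc aG bG → IsCut aF bF aG bG f cF g cG n x y → h n x = y :=
    fun n x y hy hxy => le_antisymm
      ((hcut n x).le_of_le hF hG hknead (hdense n) (hmem n x) hy hxy le_rfl)
      (hxy.le_of_le hF hG hknead (hdense n) hy (hmem n x) (hcut n x) le_rfl)
  have hsame : ∀ n, ∀ x ∈ critSet aF bF f cF n, SameItinerary f cF g cG n x (h n x) := by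
    intro n x hx
    obtain ⟨y, hy, hxy⟩ := exists_sameItinerary hF hG hknead hx
    rwa [huniq n x y hy (hxy.isCut hF hG hx.1 hy)]
  have hsurj : ∀ n, SurjOn (h n) (critSet aF bF f cF n) (critSet aG bG g cG n) := by
    intro n y hy
    obtain ⟨x, hx, hyx⟩ := exists_sameItinerary hG hF hknead.symm hy
    exact ⟨x, hyx.mem_critSet hx hy, huniq n x y hy.1 (hyx.symm.isCut hF hG hx hy.1)⟩
  have hstrict : ∀ n, StrictMonoOn (h n) (critSet aF bF f cF n) := fun n u hu v hv huv =>
    ((hsame n u hu).lt_iff_lt_and hF hG hu hv.1 (hmem n u) (hmem n v) (hsame n v hv)).1.1 huv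
  have hsub : ∀ n, critSet aG bG g cG n ⊆ h n '' Icc aF bF := fun n =>
    (hsurj n).trans (image_mono fun _ hx => hx.1)
  have hcont : ∀ n, ContinuousOn (h n) (Icc aF bF) := fun n =>
    ((hmono n).monotoneOn _).continuousOn_Icc_of_subset_closure_image (fun x _ => hmem n x)
      ((hdense n).trans (closure_mono (hsub n)))
  have hconj : ∀ n, ∀ x ∈ Icc aF bF, h (n + 1) (f n x) = g n (h n x) := fun n x hx =>
    huniq _ _ _ (hG.mapsTo n (hmem n x)) ((hcut n x).map hF hG hknead hx (hmem n x))
  exact ⟨h, fun n => (hmono n).monotoneOn _, hcont, fun n x _ => hmem n x,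
    fun n => (hdense n).trans
      (closure_minimal (hsub n) (isCompact_Icc.image_of_continuousOn (hcont n)).isClosed),
    hconj, hstrict,
    fun n => ⟨fun x hx => (hsame n x hx).mem_critSet (hmem n x) hx, (hstrict n).injOn, hsurj n⟩,
    fun n x hx => hconj n x hx.1.1⟩
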